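/- Let ω be a finite measure and suppose ∑_{Q ∈ D} K(Q) ω(Q) (∫_Q f dσ) ((1/ω(Q)) ∑_{Q' ⊆ Q} K(Q') ω(Q') ∫_{Q'} f dσ)^{q-1} ≤ A ‖f‖_{L^p(dσ)}^q for all nonnegative f ∈ L^p(dσ), where 1 < q < p < ∞. Then for all nonnegative g, ∫ g(x) W^q_{K,ω}[σ](x) dσ(x) ≤ C(p,q) A ‖g‖_{L^{p/q}(dσ)}, where W^q_{K,ω}[σ](x) = ∑_Q K(Q) ω(Q) ((1/ω(Q)) ∑_{Q'⊆Q} K(Q') ω(Q') σ(Q'))^{q-1} 1_Q(x). -/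

import Mathlib

open MeasureTheory ENNReal Classical

noncomputable section

def dyadicCube (n : ℕ) (i : ℤ) (k : Fin n → ℤ) : Set (Fin n → ℝ) :=
  {x | ∀ j, (k j : ℝ) * 2 ^ (-i) ≤ x j ∧ x j < ((k j : ℝ) + 1) * 2 ^ (-i)}

def cube (n : ℕ) (P : ℤ × (Fin n → ℤ)) : Set (Fin n → ℝ) := dyadicCube n P.1 P.2

def wolffPot (n : ℕ) (K : ℤ × (Fin n → ℤ) → ℝ≥0∞) (ω σ : Measure (Fin n → ℝ))
    (q : ℝ) (x : Fin n → ℝ) : ℝ≥0∞ :=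
  ∑' P : ℤ × (Fin n → ℤ), (cube n P).indicator
    (fun _ => K P * ω (cube n P) *
      ((∑' P' : ℤ × (Fin n → ℤ),
          if cube n P' ⊆ cube n P then K P' * ω (cube n P') * σ (cube n P') else 0) /
        ω (cube n P)) ^ (q - 1)) x

lemma measurableSet_cube (n : ℕ) (P : ℤ × (Fin n → ℤ)) : MeasurableSet (cube n P) := by
  have : cube n P = Set.univ.pi fun j =>
      Set.Ico ((P.2 j : ℝ) * 2 ^ (-P.1)) (((P.2 j : ℝ) + 1) * 2 ^ (-P.1)) := by
    ext x; simp [cube, dyadicCube]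
  rw [this]
  exact MeasurableSet.univ_pi fun _ => measurableSet_Ico

lemma measure_cube_lt_top {n : ℕ} (σ : Measure (Fin n → ℝ)) [IsLocallyFiniteMeasure σ]
    (P : ℤ × (Fin n → ℤ)) : σ (cube n P) < ⊤ := by
  refine lt_of_le_of_lt (measure_mono (t := Set.Icc
    (fun j => (P.2 j : ℝ) * 2 ^ (-P.1)) (fun j => ((P.2 j : ℝ) + 1) * 2 ^ (-P.1))) ?_)
    isCompact_Icc.measure_lt_top
  exact fun x hx => ⟨fun j => (hx j).1, fun j => (hx j).2.le⟩

lemma cube_subset_of_le {n : ℕ} {P R : ℤ × (Fin n → ℤ)} (h : P.1 ≤ R.1) {x : Fin n → ℝ}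
    (hP : x ∈ cube n P) (hR : x ∈ cube n R) : cube n R ⊆ cube n P := by
  obtain ⟨i, k⟩ := P
  obtain ⟨j, l⟩ := R
  obtain ⟨d, rfl⟩ : ∃ d : ℕ, j = i + d := ⟨(j - i).toNat, by simp only at h; omega⟩
  intro y hy m
  have hx1 := hP m
  have hx2 := hR m
  have hy := hy m
  simp only at hx1 hx2 hy ⊢
  have hpos : (0 : ℝ) < 2 ^ (-(i + (d : ℤ))) := by positivity
  have hscale : (2 : ℝ) ^ (-i) = ((2 ^ d : ℤ) : ℝ) * 2 ^ (-(i + (d : ℤ))) := by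
    push_cast
    rw [neg_add, zpow_add₀ two_ne_zero, zpow_neg _ (d : ℤ), zpow_natCast]
    field_simp
  rw [hscale] at hx1 ⊢
  simp only [← mul_assoc] at hx1 ⊢
  have h1 : k m * 2 ^ d < l m + 1 := by
    have := lt_of_mul_lt_mul_right (hx1.1.trans_lt hx2.2) hpos.le
    exact_mod_cast this
  have h2 : l m < (k m + 1) * 2 ^ d := by
    have := lt_of_mul_lt_mul_right (hx2.1.trans_lt hx1.2) hpos.le
    exact_mod_cast this
  have h1' : (k m : ℝ) * ((2 ^ d : ℤ) : ℝ) ≤ l m := by exact_mod_cast Int.lt_add_one_iff.mp h1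
  have h2' : (l m : ℝ) + 1 ≤ ((k m : ℝ) + 1) * ((2 ^ d : ℤ) : ℝ) := by
    exact_mod_cast Int.add_one_le_iff.mpr h2
  exact ⟨(mul_le_mul_of_nonneg_right h1' hpos.le).trans hy.1,
    hy.2.trans_le (mul_le_mul_of_nonneg_right h2' hpos.le)⟩

lemma cube_nested_or_disjoint (n : ℕ) (P R : ℤ × (Fin n → ℤ)) :
    cube n P ⊆ cube n R ∨ cube n R ⊆ cube n P ∨ Disjoint (cube n P) (cube n R) := by
  by_cases hd : Disjoint (cube n P) (cube n R)
  · exact .inr (.inr hd)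
  · obtain ⟨x, hP, hR⟩ := Set.not_disjoint_iff.mp hd
    rcases le_total P.1 R.1 with h | h
    · exact .inr (.inl (cube_subset_of_le h hP hR))
    · exact .inl (cube_subset_of_le h hR hP)

/-- A measure inequality valid on each member of a finite laminar family of sets passes to the
union of the family. -/
lemma measure_biUnion_le_of_laminar {α ι : Type*} [MeasurableSpace α] {μ ν : Measure α}
    {c : ι → Set α} (hc : ∀ i, MeasurableSet (c i))
    (hlam : ∀ i j, c i ⊆ c j ∨ c j ⊆ c i ∨ Disjoint (c i) (c j))
    (F : Finset ι) (h : ∀ i ∈ F, μ (c i) ≤ ν (c i)) :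
    μ (⋃ i ∈ F, c i) ≤ ν (⋃ i ∈ F, c i) := by
  induction F using Finset.strongInduction with
  | H F ih =>
    rcases F.eq_empty_or_nonempty with rfl | ⟨i, hi⟩
    · simp
    by_cases hsub : ∃ j ∈ F.erase i, c i ⊆ c j
    · obtain ⟨j, hj, hij⟩ := hsub
      have hU : ⋃ k ∈ F, c k = ⋃ k ∈ F.erase i, c k := by
        rw [← Finset.insert_erase hi, Finset.set_biUnion_insert, Finset.erase_insert_eq_erase,
          Finset.erase_idem]
        exact Set.union_eq_right.mpr (hij.trans (Set.subset_biUnion_of_mem (u := c) hj))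
      rw [hU]
      exact ih _ (Finset.erase_ssubset hi) fun k hk => h k (Finset.mem_of_mem_erase hk)
    · set G := (F.erase i).filter fun j => Disjoint (c i) (c j)
      have hGF : G ⊂ F := (Finset.filter_subset _ _).trans_ssubset (Finset.erase_ssubset hi)
      have hU : ⋃ k ∈ F, c k = c i ∪ ⋃ k ∈ G, c k := by
        refine subset_antisymm (Set.iUnion₂_subset fun k hk => ?_)
          (Set.union_subset (Set.subset_biUnion_of_mem (u := c) hi)
            (Set.biUnion_subset_biUnion_left fun k hk => hGF.subset hk))
        by_cases hki : k = i
        · rw [hki]; exact Set.subset_union_left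
        have hk' : k ∈ F.erase i := Finset.mem_erase.mpr ⟨hki, hk⟩
        rcases hlam i k with h1 | h1 | h1
        · exact absurd ⟨k, hk', h1⟩ hsub
        · exact h1.trans Set.subset_union_left
        · exact (Set.subset_biUnion_of_mem (u := c) (Finset.mem_filter.mpr ⟨hk', h1⟩)).trans
            Set.subset_union_right
      have hdis : Disjoint (c i) (⋃ k ∈ G, c k) :=
        Set.disjoint_iUnion₂_right.mpr fun k hk => (Finset.mem_filter.mp hk).2
      have hm : MeasurableSet (⋃ k ∈ G, c k) := G.measurableSet_biUnion fun k _ => hc k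
      rw [hU, measure_union hdis hm, measure_union hdis hm]
      exact add_le_add (h i hi) (ih G hGF fun k hk => h k (hGF.subset hk))

lemma measure_iUnion_le_of_laminar {α ι : Type*} [Countable ι] [MeasurableSpace α]
    {μ ν : Measure α} {c : ι → Set α} (hc : ∀ i, MeasurableSet (c i))
    (hlam : ∀ i j, c i ⊆ c j ∨ c j ⊆ c i ∨ Disjoint (c i) (c j))
    (h : ∀ i, μ (c i) ≤ ν (c i)) :
    μ (⋃ i, c i) ≤ ν (⋃ i, c i) := by
  have hdir : Directed (· ⊆ ·) fun F : Finset ι => ⋃ i ∈ F, c i :=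
    directed_of_isDirected_le fun F G hFG => Set.biUnion_subset_biUnion_left hFG
  rw [Set.iUnion_eq_iUnion_finset, hdir.measure_iUnion, hdir.measure_iUnion]
  exact iSup_mono fun F => measure_biUnion_le_of_laminar hc hlam F fun i _ => h i

/-- The dyadic maximal function with respect to the measure `σ`. -/
def dyadicMaximal (n : ℕ) (σ : Measure (Fin n → ℝ)) (g : (Fin n → ℝ) → ℝ≥0∞)
    (x : Fin n → ℝ) : ℝ≥0∞ :=
  ⨆ P : ℤ × (Fin n → ℤ),
    (cube n P).indicator (fun _ => (∫⁻ y in cube n P, g y ∂σ) / σ (cube n P)) x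

lemma measurable_dyadicMaximal (n : ℕ) (σ : Measure (Fin n → ℝ)) (g : (Fin n → ℝ) → ℝ≥0∞) :
    Measurable (dyadicMaximal n σ g) :=
  Measurable.iSup fun P => measurable_const.indicator (measurableSet_cube n P)

lemma average_le_dyadicMaximal {n : ℕ} (σ : Measure (Fin n → ℝ)) (g : (Fin n → ℝ) → ℝ≥0∞)
    {P : ℤ × (Fin n → ℤ)} {x : Fin n → ℝ} (hx : x ∈ cube n P) :
    (∫⁻ y in cube n P, g y ∂σ) / σ (cube n P) ≤ dyadicMaximal n σ g x := by
  refine le_trans (le_of_eq ?_) (le_iSup _ P)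
  rw [Set.indicator_of_mem hx]

/-- Weak-type estimate for the dyadic maximal function, localised to the set where `g` is large. -/
lemma measure_lt_dyadicMaximal_le {n : ℕ} (σ : Measure (Fin n → ℝ)) [IsLocallyFiniteMeasure σ]
    {g : (Fin n → ℝ) → ℝ≥0∞} (hg : Measurable g) {t : ℝ≥0∞} (ht : t ≠ ⊤) :
    t * σ {x | t < dyadicMaximal n σ g x} ≤ 2 * ∫⁻ x in {x | t < 2 * g x}, g x ∂σ := by
  set E := {x | t < 2 * g x}
  have hEm : MeasurableSet E := measurableSet_lt measurable_const (hg.const_mul 2)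
  let S := {P : ℤ × (Fin n → ℤ) // t < (∫⁻ y in cube n P, g y ∂σ) / σ (cube n P)}
  have hset : {x | t < dyadicMaximal n σ g x} = ⋃ P : S, cube n P.1 := by
    ext x
    simp only [Set.mem_ofPred_eq, dyadicMaximal, lt_iSup_iff, Set.mem_iUnion]
    constructor
    · rintro ⟨P, hP⟩
      by_cases hx : x ∈ cube n P
      · rw [Set.indicator_of_mem hx] at hP
        exact ⟨⟨P, hP⟩, hx⟩
      · rw [Set.indicator_of_notMem hx] at hP
        exact absurd hP ENNReal.not_lt_zero
    · rintro ⟨P, hx⟩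
      exact ⟨P.1, by rw [Set.indicator_of_mem hx]; exact P.2⟩
  have key : ∀ P : S, (t • σ) (cube n P.1) ≤
      (2 • σ.withDensity (E.indicator g)) (cube n P.1) := by
    rintro ⟨P, hP⟩
    have hfin := (measure_cube_lt_top σ P).ne
    have h1 : t * σ (cube n P) ≤ ∫⁻ y in cube n P, g y ∂σ := ENNReal.mul_le_of_le_div hP.le
    have h2 : 2 * ∫⁻ y in cube n P, g y ∂σ ≤
        2 * (∫⁻ y in cube n P, E.indicator g y ∂σ) + t * σ (cube n P) := by
      have hI : Measurable (E.indicator g) := hg.indicator hEm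
      rw [← lintegral_const_mul _ hg, ← lintegral_const_mul _ hI, ← setLIntegral_const,
        ← lintegral_add_right _ measurable_const]
      refine lintegral_mono fun y => ?_
      by_cases hy : y ∈ E
      · simp [Set.indicator_of_mem hy]
      · simpa [Set.indicator_of_notMem hy] using not_lt.mp hy
    have h3 : t * σ (cube n P) + t * σ (cube n P) ≤
        2 * (∫⁻ y in cube n P, E.indicator g y ∂σ) + t * σ (cube n P) := by
      rw [← two_mul]
      exact (mul_le_mul_right h1 2).trans h2
    have h4 := (ENNReal.add_le_add_iff_right (ENNReal.mul_ne_top ht hfin)).mp h3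
    simpa [withDensity_apply _ (measurableSet_cube n P)] using h4
  have := measure_iUnion_le_of_laminar (fun P : S => measurableSet_cube n P.1)
    (fun P R => cube_nested_or_disjoint n P.1 R.1) key
  rw [← hset] at this
  calc t * σ {x | t < dyadicMaximal n σ g x}
      ≤ (2 • σ.withDensity (E.indicator g)) {x | t < dyadicMaximal n σ g x} := this
    _ ≤ (2 • σ.withDensity (E.indicator g)) Set.univ := measure_mono (Set.subset_univ _)
    _ = _ := by simp [lintegral_indicator hEm]

lemma setLIntegral_Ioo_rpow {s c : ℝ} (hs : 0 < s) (hc : 0 ≤ c) :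
    ∫⁻ t in Set.Ioo 0 c, ENNReal.ofReal (t ^ (s - 1)) = ENNReal.ofReal (c ^ s / s) := by
  have hint : IntervalIntegrable (fun t : ℝ => t ^ (s - 1)) volume 0 c :=
    intervalIntegral.intervalIntegrable_rpow' (by linarith)
  rw [← ofReal_integral_eq_lintegral_ofReal, ← integral_Ioc_eq_integral_Ioo,
    ← intervalIntegral.integral_of_le hc, integral_rpow (.inl (by linarith))]
  · simp [Real.zero_rpow hs.ne']
  · exact ((intervalIntegrable_iff_integrableOn_Ioc_of_le hc).mp hint).mono_set
      Set.Ioo_subset_Ioc_self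
  · filter_upwards [ae_restrict_mem measurableSet_Ioo] with t ht
    exact Real.rpow_nonneg ht.1.le _

/-- The layer cake representation of a power on `[0, ∞]`. -/
lemma lintegral_Ioi_indicator_rpow {s : ℝ} (hs : 0 < s) (y : ℝ≥0∞) :
    ∫⁻ t in Set.Ioi (0 : ℝ), {t | ENNReal.ofReal t < y}.indicator
      (fun t => ENNReal.ofReal (t ^ (s - 1))) t = y ^ s / ENNReal.ofReal s := by
  have hfin : ∀ c : ℝ, 0 ≤ c → ∫⁻ t in Set.Ioi (0 : ℝ),
      {t | ENNReal.ofReal t < ENNReal.ofReal c}.indicator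
        (fun t => ENNReal.ofReal (t ^ (s - 1))) t =
      ENNReal.ofReal c ^ s / ENNReal.ofReal s := by
    intro c hc
    have hm : MeasurableSet {t : ℝ | ENNReal.ofReal t < ENNReal.ofReal c} :=
      measurableSet_lt ENNReal.measurable_ofReal measurable_const
    rw [lintegral_indicator hm, Measure.restrict_restrict hm]
    have : {t : ℝ | ENNReal.ofReal t < ENNReal.ofReal c} ∩ Set.Ioi 0 = Set.Ioo 0 c := by
      ext t
      simp only [Set.mem_inter_iff, Set.mem_ofPred_eq, Set.mem_Ioi, Set.mem_Ioo]
      constructor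
      · rintro ⟨h1, h2⟩
        exact ⟨h2, (ENNReal.ofReal_lt_ofReal_iff_of_nonneg h2.le).mp h1⟩
      · rintro ⟨h1, h2⟩
        exact ⟨(ENNReal.ofReal_lt_ofReal_iff_of_nonneg h1.le).mpr h2, h1⟩
    rw [this, setLIntegral_Ioo_rpow hs hc, ENNReal.ofReal_div_of_pos hs,
      ENNReal.ofReal_rpow_of_nonneg hc hs.le]
  by_cases hy : y = ⊤
  · subst hy
    rw [ENNReal.top_rpow_of_pos hs, ENNReal.top_div_of_ne_top ENNReal.ofReal_ne_top]
    refine ENNReal.eq_top_of_forall_nnreal_le fun b => ?_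
    set c : ℝ := (b * s) ^ s⁻¹ with hc
    have hc0 : 0 ≤ c := by positivity
    have hb : ENNReal.ofReal c ^ s / ENNReal.ofReal s = b := by
      rw [ENNReal.ofReal_rpow_of_nonneg hc0 hs.le, ← ENNReal.ofReal_div_of_pos hs, hc,
        Real.rpow_inv_rpow (by positivity) hs.ne', mul_div_cancel_right₀ _ hs.ne',
        ENNReal.ofReal_coe_nnreal]
    rw [← hb, ← hfin c hc0]
    refine lintegral_mono fun t => Set.indicator_le_indicator_of_subset
      (fun t _ => ?_) (fun _ => zero_le) t
    exact ENNReal.ofReal_lt_top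
  · rw [← ENNReal.ofReal_toReal hy]
    exact hfin _ ENNReal.toReal_nonneg

/-- Strong-type estimate for the dyadic maximal function. -/
lemma lintegral_dyadicMaximal_rpow_le {n : ℕ} (σ : Measure (Fin n → ℝ))
    [IsLocallyFiniteMeasure σ] {r : ℝ} (hr : 1 < r) {g : (Fin n → ℝ) → ℝ≥0∞}
    (hg : Measurable g) :
    ∫⁻ x, dyadicMaximal n σ g x ^ r ∂σ ≤
      ENNReal.ofReal (r * 2 ^ r / (r - 1)) * ∫⁻ x, g x ^ r ∂σ := by
  have hr0 : 0 < r := by linarith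
  have hr1 : 0 < r - 1 := by linarith
  have hM := measurable_dyadicMaximal n σ g
  have hswap : ∀ (F h : (Fin n → ℝ) → ℝ≥0∞) (s : ℝ), Measurable F → Measurable h →
      ∫⁻ x, h x * (∫⁻ t in Set.Ioi (0 : ℝ), {t | ENNReal.ofReal t < F x}.indicator
        (fun t => ENNReal.ofReal (t ^ (s - 1))) t) ∂σ =
      ∫⁻ t in Set.Ioi (0 : ℝ), ENNReal.ofReal (t ^ (s - 1)) *
        ∫⁻ x in {x | ENNReal.ofReal t < F x}, h x ∂σ := by
    intro F h s hF hh
    have hpow : Measurable fun t : ℝ => ENNReal.ofReal (t ^ (s - 1)) := by fun_prop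
    have hmx : ∀ x, MeasurableSet {t : ℝ | ENNReal.ofReal t < F x} := fun x =>
      measurableSet_lt ENNReal.measurable_ofReal measurable_const
    have hmt : ∀ t : ℝ, MeasurableSet {x | ENNReal.ofReal t < F x} := fun t =>
      measurableSet_lt measurable_const hF
    calc _ = ∫⁻ x, (∫⁻ t in Set.Ioi (0 : ℝ), {z : (Fin n → ℝ) × ℝ |
            ENNReal.ofReal z.2 < F z.1}.indicator
              (fun z => h z.1 * ENNReal.ofReal (z.2 ^ (s - 1))) (x, t)) ∂σ := by
          refine lintegral_congr fun x => ?_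
          rw [← lintegral_const_mul _ (hpow.indicator (hmx x))]
          refine lintegral_congr fun t => ?_
          simp [Set.indicator_apply]
      _ = ∫⁻ t in Set.Ioi (0 : ℝ), ∫⁻ x, {z : (Fin n → ℝ) × ℝ |
            ENNReal.ofReal z.2 < F z.1}.indicator
              (fun z => h z.1 * ENNReal.ofReal (z.2 ^ (s - 1))) (x, t) ∂σ := by
          refine lintegral_lintegral_swap (Measurable.aemeasurable ?_)
          refine Measurable.indicator ((hh.comp measurable_fst).mul (hpow.comp measurable_snd)) ?_
          exact measurableSet_lt (ENNReal.measurable_ofReal.comp measurable_snd)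
            (hF.comp measurable_fst)
      _ = _ := by
          refine lintegral_congr fun t => ?_
          rw [← lintegral_indicator (hmt t), ← lintegral_const_mul _ (hh.indicator (hmt t))]
          refine lintegral_congr fun x => ?_
          simp [Set.indicator_apply, mul_comm]
  have hLHS : (∫⁻ x, dyadicMaximal n σ g x ^ r ∂σ) / ENNReal.ofReal r =
      ∫⁻ t in Set.Ioi (0 : ℝ), ENNReal.ofReal (t ^ (r - 1)) *
        σ {x | ENNReal.ofReal t < dyadicMaximal n σ g x} := by
    have := hswap (dyadicMaximal n σ g) (fun _ => 1) r hM measurable_const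
    simp only [one_mul, lintegral_Ioi_indicator_rpow hr0, setLIntegral_one] at this
    rw [← this]
    simp only [div_eq_mul_inv]
    rw [lintegral_mul_const _ (hM.pow_const r)]
  have hRHS : ∫⁻ t in Set.Ioi (0 : ℝ), ENNReal.ofReal (t ^ (r - 1 - 1)) *
        ∫⁻ x in {x | ENNReal.ofReal t < 2 * g x}, g x ∂σ =
      2 ^ (r - 1) / ENNReal.ofReal (r - 1) * ∫⁻ x, g x ^ r ∂σ := by
    rw [← hswap (fun x => 2 * g x) g (r - 1) (hg.const_mul 2) hg,
      ← lintegral_const_mul _ (hg.pow_const r)]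
    refine lintegral_congr fun x => ?_
    rw [lintegral_Ioi_indicator_rpow hr1, ENNReal.mul_rpow_of_nonneg _ _ hr1.le]
    have : g x ^ r = g x * g x ^ (r - 1) := by
      conv_rhs => rw [← ENNReal.rpow_one (g x), ← ENNReal.rpow_mul, one_mul]
      rw [← ENNReal.rpow_add_of_nonneg _ _ zero_le_one hr1.le]
      congr 1; ring
    rw [this]
    simp only [div_eq_mul_inv]
    ring
  have hle : (∫⁻ x, dyadicMaximal n σ g x ^ r ∂σ) / ENNReal.ofReal r ≤
      2 * (2 ^ (r - 1) / ENNReal.ofReal (r - 1) * ∫⁻ x, g x ^ r ∂σ) := by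
    rw [hLHS, ← hRHS, ← lintegral_const_mul' _ _ ENNReal.ofNat_ne_top]
    refine setLIntegral_mono' measurableSet_Ioi fun t ht => ?_
    have ht : 0 < t := ht
    have hsplit : ENNReal.ofReal (t ^ (r - 1)) =
        ENNReal.ofReal (t ^ (r - 1 - 1)) * ENNReal.ofReal t := by
      rw [← ENNReal.ofReal_mul (by positivity), Real.rpow_sub_one ht.ne' (r - 1),
        div_mul_cancel₀ _ ht.ne']
    rw [hsplit, mul_assoc, mul_left_comm 2]
    exact mul_le_mul_right (measure_lt_dyadicMaximal_le σ hg ENNReal.ofReal_ne_top) _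
  have hconst : ENNReal.ofReal (r * 2 ^ r / (r - 1)) =
      2 * (2 ^ (r - 1) / ENNReal.ofReal (r - 1)) * ENNReal.ofReal r := by
    have h2 : (2 : ℝ≥0∞) ^ (r - 1) = ENNReal.ofReal (2 ^ (r - 1)) := by
      rw [← ENNReal.ofReal_rpow_of_pos two_pos]; simp
    have h2' : (2 : ℝ≥0∞) = ENNReal.ofReal 2 := by simp
    rw [h2, ← ENNReal.ofReal_div_of_pos hr1, h2', ← ENNReal.ofReal_mul two_pos.le,
      ← ENNReal.ofReal_mul (by positivity)]
    congr 1
    rw [Real.rpow_sub_one two_ne_zero]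
    ring
  rw [ENNReal.div_le_iff (by simpa using hr0) ENNReal.ofReal_ne_top] at hle
  rw [hconst]
  refine hle.trans (le_of_eq ?_)
  ring

/-- The powers of an average of `g` over `P` are dominated by integrals of the same power of the
maximal function over any subcube. -/
lemma average_rpow_mul_measure_le {n : ℕ} (σ : Measure (Fin n → ℝ)) (g : (Fin n → ℝ) → ℝ≥0∞)
    {s : ℝ} (hs : 0 ≤ s) {P P' : ℤ × (Fin n → ℤ)} (h : cube n P' ⊆ cube n P) :
    ((∫⁻ y in cube n P, g y ∂σ) / σ (cube n P)) ^ s * σ (cube n P') ≤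
      ∫⁻ y in cube n P', dyadicMaximal n σ g y ^ s ∂σ := by
  rw [← setLIntegral_const]
  exact setLIntegral_mono' (measurableSet_cube n P') fun x hx =>
    ENNReal.rpow_le_rpow (average_le_dyadicMaximal σ g (h hx)) hs

lemma lintegral_mul_wolffPot {n : ℕ} (K : ℤ × (Fin n → ℤ) → ℝ≥0∞) (ω σ : Measure (Fin n → ℝ))
    (q : ℝ) {g : (Fin n → ℝ) → ℝ≥0∞} (hg : Measurable g) :
    ∫⁻ x, g x * wolffPot n K ω σ q x ∂σ =
      ∑' P : ℤ × (Fin n → ℤ), (K P * ω (cube n P) *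
        ((∑' P' : ℤ × (Fin n → ℤ),
          if cube n P' ⊆ cube n P then K P' * ω (cube n P') * σ (cube n P') else 0) /
        ω (cube n P)) ^ (q - 1)) * ∫⁻ x in cube n P, g x ∂σ := by
  simp only [wolffPot, ← ENNReal.tsum_mul_left]
  rw [lintegral_tsum]
  swap
  · exact fun P =>
      (hg.mul (measurable_const.indicator (measurableSet_cube n P))).aemeasurable
  refine tsum_congr fun P => ?_
  rw [← lintegral_const_mul _ hg, ← lintegral_indicator (measurableSet_cube n P)]
  refine lintegral_congr fun x => ?_
  by_cases hx : x ∈ cube n P <;> simp [hx, mul_comm]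

theorem wolff_pairing_bound (n : ℕ) (p q : ℝ) (hq : 1 < q) (hqp : q < p) :
    ∃ C : ℝ≥0∞, 0 < C ∧ C < ⊤ ∧
      ∀ (σ ω : Measure (Fin n → ℝ)), IsLocallyFiniteMeasure σ → IsFiniteMeasure ω →
        ∀ (K : ℤ × (Fin n → ℤ) → ℝ≥0∞) (A : ℝ≥0∞),
        (∀ f : (Fin n → ℝ) → ℝ≥0∞, Measurable f →
          ∑' P : ℤ × (Fin n → ℤ), K P * ω (cube n P) * (∫⁻ y in cube n P, f y ∂σ) *
              ((∑' P' : ℤ × (Fin n → ℤ),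
                  if cube n P' ⊆ cube n P then
                    K P' * ω (cube n P') * ∫⁻ y in cube n P', f y ∂σ
                  else 0) / ω (cube n P)) ^ (q - 1) ≤
            A * (∫⁻ x, f x ^ p ∂σ) ^ (q / p)) →
        ∀ g : (Fin n → ℝ) → ℝ≥0∞, Measurable g →
          ∫⁻ x, g x * wolffPot n K ω σ q x ∂σ ≤
            A * C * (∫⁻ x, g x ^ (p / q) ∂σ) ^ (q / p) := by
  have hq0 : 0 < q := by linarith
  have hp0 : 0 < p := by linarith
  have hr : 1 < p / q := (one_lt_div hq0).mpr hqp
  have hC : 0 < p / q * 2 ^ (p / q) / (p / q - 1) :=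
    div_pos (by positivity) (by linarith)
  refine ⟨ENNReal.ofReal (p / q * 2 ^ (p / q) / (p / q - 1)) ^ (q / p),
    ENNReal.rpow_pos (ENNReal.ofReal_pos.mpr hC) ENNReal.ofReal_ne_top,
    ENNReal.rpow_lt_top_of_nonneg (by positivity) ENNReal.ofReal_ne_top, ?_⟩
  intro σ ω _ _ K A hA g hg
  have hf := hA (fun x => dyadicMaximal n σ g x ^ q⁻¹)
    ((measurable_dyadicMaximal n σ g).pow_const _)
  have hfp : ∀ x, (dyadicMaximal n σ g x ^ q⁻¹) ^ p = dyadicMaximal n σ g x ^ (p / q) :=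
    fun x => by rw [← ENNReal.rpow_mul, inv_mul_eq_div]
  simp only [hfp] at hf
  rw [lintegral_mul_wolffPot K ω σ q hg]
  refine le_trans (ENNReal.tsum_le_tsum fun P => ?_) (hf.trans ?_)
  · set a := (∫⁻ y in cube n P, g y ∂σ) / σ (cube n P) with ha
    have hga : ∫⁻ y in cube n P, g y ∂σ = a * σ (cube n P) := by
      by_cases h0 : σ (cube n P) = 0
      · rw [h0, mul_zero, setLIntegral_measure_zero _ _ h0]
      · rw [ha, ENNReal.div_mul_cancel h0 (measure_cube_lt_top σ P).ne]
    have haq : a = a ^ q⁻¹ * (a ^ q⁻¹) ^ (q - 1) := by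
      have hq1 : 0 ≤ q⁻¹ * (q - 1) := mul_nonneg (by positivity) (by linarith)
      rw [← ENNReal.rpow_mul, ← ENNReal.rpow_add_of_nonneg _ _ (by positivity) hq1]
      have : q⁻¹ + q⁻¹ * (q - 1) = 1 := by field_simp; ring
      rw [this, ENNReal.rpow_one]
    have hsum : a ^ q⁻¹ * (∑' P' : ℤ × (Fin n → ℤ),
          if cube n P' ⊆ cube n P then K P' * ω (cube n P') * σ (cube n P') else 0) ≤
        ∑' P' : ℤ × (Fin n → ℤ), if cube n P' ⊆ cube n P then
          K P' * ω (cube n P') * ∫⁻ y in cube n P', dyadicMaximal n σ g y ^ q⁻¹ ∂σ else 0 := by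
      rw [← ENNReal.tsum_mul_left]
      refine ENNReal.tsum_le_tsum fun P' => ?_
      split_ifs with h
      · rw [mul_left_comm]
        exact mul_le_mul_right (average_rpow_mul_measure_le σ g (by positivity) h) _
      · simp
    have hself : a ^ q⁻¹ * σ (cube n P) ≤
        ∫⁻ y in cube n P, dyadicMaximal n σ g y ^ q⁻¹ ∂σ :=
      average_rpow_mul_measure_le σ g (by positivity) subset_rfl
    set S := ∑' P' : ℤ × (Fin n → ℤ),
      if cube n P' ⊆ cube n P then K P' * ω (cube n P') * σ (cube n P') else 0
    calc K P * ω (cube n P) * (S / ω (cube n P)) ^ (q - 1) * ∫⁻ y in cube n P, g y ∂σ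
        = K P * ω (cube n P) * (a ^ q⁻¹ * σ (cube n P)) *
            ((a ^ q⁻¹ * S) / ω (cube n P)) ^ (q - 1) := by
          rw [hga, mul_div_assoc, ENNReal.mul_rpow_of_nonneg _ _ (by linarith : 0 ≤ q - 1)]
          conv_lhs => rw [haq]
          ring
      _ ≤ _ := by
          gcongr
  · rw [mul_assoc, ← ENNReal.mul_rpow_of_nonneg _ _ (by positivity)]
    gcongr
    exact lintegral_dyadicMaximal_rpow_le σ hr hg

end
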